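/- arXiv:2504.12404 — 3 statements merged into one kernel-verified Lean document; each statement's English description precedes it below -/
import Mathlib

section
/- For every real number c > 1 and every ε > 0, there exist natural numbers m ≥ 11 and M ≥ 4 such that both real numbers 1 + log(m − 1)/log(2·M − 5) and 1 + log(⌊(m − 5)/3⌋)/log(2·M − 1) lie within distance ε of c. (This is the numerical content of Corollary 3.9: the sandwiching lower and upper bounds on conformal dimension achieve a dense set of values in (1, ∞).) -/
open Real

theorem confdim_aux (a ε L y z : ℝ) (ha : 0 < a) (hL : 1 ≤ L)
    (h1 : a + 2 ≤ ε * L) (h2 : 2 ≤ a * L)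
    (hy1 : exp (a * L) / 6 ≤ y) (hy2 : y ≤ exp (a * L))
    (hz1 : exp L ≤ z) (hz2 : z ≤ 2 * exp L) (c : ℝ) (hc : c = a + 1) (hε : 0 < ε) :
    |1 + Real.log y / Real.log z - c| ≤ ε := by
  have hz0 : 0 < z := (exp_pos L).trans_le hz1
  have hy0 : 0 < y := lt_of_lt_of_le (by positivity) hy1
  have e1 := Real.add_one_le_exp (1 : ℝ)
  have e2 : (6 : ℝ) ≤ exp 2 := by
    have h := Real.exp_one_gt_d9
    have : exp 2 = exp 1 * exp 1 := by rw [← exp_add]; norm_num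
    rw [this]; nlinarith
  have ly1 : a * L - 2 ≤ log y := by
    rw [le_log_iff_exp_le hy0, exp_sub]
    refine le_trans ?_ hy1
    gcongr
  have ly2 : log y ≤ a * L := (log_le_iff_le_exp hy0).2 hy2
  have lz1 : L ≤ log z := (le_log_iff_exp_le hz0).2 hz1
  have lz2 : log z ≤ L + 1 := by
    rw [log_le_iff_le_exp hz0, exp_add]
    nlinarith [exp_pos L]
  have hzp : 0 < log z := by linarith
  have : 1 + Real.log y / Real.log z - c = Real.log y / Real.log z - a := by rw [hc]; ring
  rw [this, abs_le]
  constructor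
  · have : a - ε ≤ log y / log z := by
      rw [le_div_iff₀ hzp]
      nlinarith
    linarith
  · have : log y / log z ≤ a := by
      rw [div_le_iff₀ hzp]
      nlinarith
    linarith

theorem confdim_dense_values (c ε : ℝ) (hc : 1 < c) (hε : 0 < ε) :
    ∃ m M : ℕ, 11 ≤ m ∧ 4 ≤ M ∧
      |1 + Real.log ((m : ℝ) - 1) / Real.log (2 * (M : ℝ) - 5) - c| ≤ ε ∧
      |1 + Real.log ((⌊((m : ℝ) - 5) / 3⌋ : ℤ) : ℝ) / Real.log (2 * (M : ℝ) - 1) - c| ≤ ε := by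
  obtain ⟨a, rfl⟩ : ∃ a, c = a + 1 := ⟨c - 1, by ring⟩
  have ha : 0 < a := by linarith
  have ht : Filter.Tendsto (fun n : ℕ => Real.log (n : ℝ)) Filter.atTop Filter.atTop :=
    Real.tendsto_log_atTop.comp tendsto_natCast_atTop_atTop
  obtain ⟨M, hM5, hL, h1, h2⟩ := ((Filter.eventually_ge_atTop 5).and
    ((ht.eventually_ge_atTop 1).and ((ht.eventually_ge_atTop ((a + 2) / ε)).and
      (ht.eventually_ge_atTop (16 / a))))).exists
  have hM : (5 : ℝ) ≤ M := by exact_mod_cast hM5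
  have heM : exp (log (M : ℝ)) = M := exp_log (by linarith)
  rw [div_le_iff₀ hε] at h1
  rw [div_le_iff₀ ha] at h2
  set L := log (M : ℝ)
  have hx : 16 ≤ exp (a * L) := by linarith [Real.add_one_le_exp (a * L)]
  have hm1 := Nat.le_ceil (exp (a * L))
  have hm2 := Nat.ceil_lt_add_one (exp_pos (a * L)).le
  set m := ⌈exp (a * L)⌉₊
  have hf1 := Int.floor_le (((m : ℝ) - 5) / 3)
  have hf2 := Int.lt_floor_add_one (((m : ℝ) - 5) / 3)
  refine ⟨m, M, ?_, by omega, ?_, ?_⟩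
  · have : (11 : ℝ) ≤ m := by linarith
    exact_mod_cast this
  all_goals
    apply confdim_aux a ε L _ _ ha hL (by linarith) (by linarith) _ _ _ _ _ rfl hε <;> linarith
end

section
/- Let G be a type, let f : G → ℝ be a nonnegative function, and let C ≥ 0 and a ≥ 0 be real constants such that for every natural number r the set {g ∈ G : f(g) ≤ r} is finite and has at most C·e^{a·r} elements. Then for every real s > a, the family g ↦ e^{−s·f(g)} is summable. (This is the convergence argument for the Poincaré series in the proof of Theorem 4.6: a growth bound of exponential rate a on metric balls forces the Poincaré series to converge for every exponent s > a.) -/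
theorem poincare_series_summable {G : Type*} (f : G → ℝ) (C a : ℝ)
    (hf : ∀ g, 0 ≤ f g) (hC : 0 ≤ C) (ha : 0 ≤ a)
    (hfin : ∀ r : ℕ, {g : G | f g ≤ (r : ℝ)}.Finite)
    (hcount : ∀ r : ℕ, (Nat.card {g : G | f g ≤ (r : ℝ)} : ℝ) ≤ C * Real.exp (a * r)) :
    ∀ s : ℝ, a < s → Summable (fun g : G => Real.exp (-s * f g)) := by
  classical
  intro s hs
  have hb : Summable (fun n : ℕ => C * Real.exp s * (Real.exp (a - s)) ^ n) :=
    (summable_geometric_of_lt_one (Real.exp_pos _).le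
      (Real.exp_lt_one_iff.2 (by linarith))).mul_left _
  refine summable_of_sum_le (c := ∑' n : ℕ, C * Real.exp s * (Real.exp (a - s)) ^ n)
    (fun g => (Real.exp_pos _).le) ?_
  intro u
  rw [← Finset.sum_fiberwise_of_maps_to (s := u) (t := u.image (fun g => ⌈f g⌉₊))
    (g := fun g => ⌈f g⌉₊) (fun g hg => Finset.mem_image_of_mem _ hg)]
  refine le_trans (Finset.sum_le_sum ?_)
    (hb.sum_le_tsum (u.image (fun g => ⌈f g⌉₊)) (fun n _ => by positivity))
  intro n _
  have hcard : (((u.filter (fun g => ⌈f g⌉₊ = n)).card : ℕ) : ℝ) ≤ C * Real.exp (a * n) := by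
    refine le_trans ?_ (hcount n)
    rw [Nat.card_coe_set_eq, ← Set.ncard_coe_finset]
    refine Nat.cast_le.2 ?_
    refine Set.ncard_le_ncard ?_ (hfin n)
    intro g hg
    have h := (Finset.mem_filter.1 hg).2
    exact Nat.ceil_le.1 h.le
  have hterm : ∀ g ∈ u.filter (fun g => ⌈f g⌉₊ = n),
      Real.exp (-s * f g) ≤ Real.exp (-s * (n - 1)) := by
    intro g hg
    have h := (Finset.mem_filter.1 hg).2
    have h2 := Nat.ceil_lt_add_one (hf g)
    rw [h] at h2
    apply Real.exp_le_exp.2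
    nlinarith
  refine (Finset.sum_le_card_nsmul _ _ _ hterm).trans ?_
  rw [nsmul_eq_mul]
  refine (mul_le_mul_of_nonneg_right hcard (Real.exp_pos _).le).trans (le_of_eq ?_)
  rw [← Real.exp_nat_mul, mul_assoc, mul_assoc, ← Real.exp_add, ← Real.exp_add]
  congr 2
  ring
end

section
/- For every real number x > 0, setting θ = π − arctan x, one has arccos(cos²θ + (1/2)·sin²θ) ≥ π/4 if and only if x ≥ 2^{1/4}. (This is the calculation of the Appendix: the side length σ₁ of the isosceles spherical triangle with two sides of length θ and apex angle π/3 satisfies σ₁ ≥ π/4 exactly when x = tan(π − θ) is at least the fourth root of 2; it determines the admissible heights y₀ of the horoball in the construction of the CAT(−1) space 𝒴_Γ.) -/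
open Real

theorem appendix_side_length_iff (x : ℝ) (hx : 0 < x) :
    Real.arccos ((Real.cos (π - Real.arctan x)) ^ 2 +
        (1 / 2) * (Real.sin (π - Real.arctan x)) ^ 2) ≥ π / 4 ↔
      x ≥ (2 : ℝ) ^ ((1 : ℝ) / 4) := by
  rw [Real.cos_pi_sub, Real.sin_pi_sub, neg_sq, Real.cos_sq_arctan, Real.sin_sq_arctan]
  have hp : 0 < 1 + x ^ 2 := by positivity
  have hs0 : 0 < √(2 : ℝ) := by positivity
  have hs : √(2 : ℝ) * √2 = 2 := Real.mul_self_sqrt (by norm_num)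
  have hs1 : 1 < √(2 : ℝ) := by nlinarith
  have he : 1 / (1 + x ^ 2) + 1 / 2 * (x ^ 2 / (1 + x ^ 2)) = (2 + x ^ 2) / (2 * (1 + x ^ 2)) := by
    field_simp
  rw [he]
  have h1 : (2 + x ^ 2) / (2 * (1 + x ^ 2)) ≤ 1 := by
    rw [div_le_one (by positivity)]; nlinarith [sq_nonneg x]
  have h0 : 0 ≤ (2 + x ^ 2) / (2 * (1 + x ^ 2)) := by positivity
  have hpi := Real.pi_pos
  have hA : Real.arccos ((2 + x ^ 2) / (2 * (1 + x ^ 2))) ≥ π / 4 ↔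
      (2 + x ^ 2) / (2 * (1 + x ^ 2)) ≤ √2 / 2 := by
    rw [← Real.cos_pi_div_four]
    conv_rhs => rw [← Real.cos_arccos (by linarith) h1]
    exact (Real.strictAntiOn_cos.le_iff_ge
      ⟨Real.arccos_nonneg _, Real.arccos_le_pi _⟩ ⟨by linarith, by linarith⟩).symm
  have hr0 : 0 < (2 : ℝ) ^ ((1 : ℝ) / 4) := by positivity
  have hr : ((2 : ℝ) ^ ((1 : ℝ) / 4)) ^ 2 = √2 := by
    rw [← Real.rpow_natCast, ← Real.rpow_mul (by norm_num), Real.sqrt_eq_rpow]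
    norm_num
  rw [hA, div_le_div_iff₀ (by positivity) (by norm_num), ge_iff_le,
    ← pow_le_pow_iff_left₀ hr0.le hx.le (two_ne_zero), hr]
  constructor
  · intro h
    have : 0 ≤ (√2 - 1) * (x ^ 2 - √2) := by nlinarith
    have := nonneg_of_mul_nonneg_right this (by linarith)
    linarith
  · intro h
    have : 0 ≤ (√2 - 1) * (x ^ 2 - √2) := mul_nonneg (by linarith) (by linarith)
    nlinarith
end
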